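/- Let M be a matroid of rank r on a ground set of size n, let C be a circuit of M with |C| = r + 1 - d for some 0 ≤ d < r + 1, and let m be the number of coloops of M. If n = r + 1 then β_C = 1, and if n > r + 1 then β_C ≥ binom(n-1-d, |C|)^{-1} - (|C|/(n-m)) · binom(n-m-1, r-m+1)^{-1}. -/

import Mathlib

open Finset

/-- A matroid presented by its collection of circuits (the valid sets of bingo
cards): nonempty ground set axioms (C1)-(C3) of the paper. -/
structure BingoMatroid (α : Type*) [DecidableEq α] where
  /-- the ground set -/
  E : Finset α
  /-- the circuits (bingo cards) -/
  circuits : Finset (Finset α)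
  subset_ground : ∀ C ∈ circuits, C ⊆ E
  empty_not_mem : ∅ ∉ circuits
  antichain : ∀ C₁ ∈ circuits, ∀ C₂ ∈ circuits, C₁ ⊆ C₂ → C₁ = C₂
  elimination : ∀ C₁ ∈ circuits, ∀ C₂ ∈ circuits, C₁ ≠ C₂ →
    ∀ e ∈ C₁ ∩ C₂, ∃ C₃ ∈ circuits, C₃ ⊆ (C₁ ∪ C₂) \ {e}

/-- The completion time `t_C(σ)`: the least `t` such that every element of `C`
has been called out among the first `t` values of `σ`. -/
noncomputable def hitTime {α : Type*} {n : ℕ} (σ : Fin n → α) (C : Finset α) : ℕ :=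
  sInf {t : ℕ | ∀ x ∈ C, ∃ i : Fin n, (i : ℕ) < t ∧ σ i = x}

namespace BingoMatroid

variable {α : Type*} [DecidableEq α]

/-- `C` wins the bingo game under calling order `σ`: it is completed strictly
before every other circuit. -/
def Wins (M : BingoMatroid α) (σ : Fin M.E.card ≃ {x // x ∈ M.E}) (C : Finset α) : Prop :=
  ∀ C' ∈ M.circuits, C' ≠ C →
    hitTime (fun i => (σ i : α)) C < hitTime (fun i => (σ i : α)) C'

/-- The winning probability `β_C`: the number of calling orders under which `C`
wins, divided by `n!`. -/
noncomputable def beta (M : BingoMatroid α) (C : Finset α) : ℚ :=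
  (Nat.card {σ : Fin M.E.card ≃ {x // x ∈ M.E} // M.Wins σ C} : ℚ) /
    (Nat.factorial M.E.card : ℚ)

/-- The timed winning probability `β_C(t)`: the probability that `C` wins and is
completed exactly in round `t`. -/
noncomputable def betaT (M : BingoMatroid α) (C : Finset α) (t : ℕ) : ℚ :=
  (Nat.card {σ : Fin M.E.card ≃ {x // x ∈ M.E} //
      M.Wins σ C ∧ hitTime (fun i => (σ i : α)) C = t} : ℚ) /
    (Nat.factorial M.E.card : ℚ)

/-- A set is independent if it is contained in the ground set and contains no circuit. -/
def Indep (M : BingoMatroid α) (I : Finset α) : Prop :=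
  I ⊆ M.E ∧ ∀ C ∈ M.circuits, ¬ C ⊆ I

/-- The rank of the matroid: the maximum size of an independent set. -/
noncomputable def rank (M : BingoMatroid α) : ℕ :=
  sSup {k : ℕ | ∃ I : Finset α, M.Indep I ∧ I.card = k}

/-- A basis is a maximal independent set. -/
def IsBase (M : BingoMatroid α) (B : Finset α) : Prop :=
  M.Indep B ∧ ∀ J : Finset α, M.Indep J → B ⊆ J → B = J

/-- A coloop is an element of the ground set contained in no circuit. -/
def IsColoop (M : BingoMatroid α) (e : α) : Prop :=
  e ∈ M.E ∧ ∀ C ∈ M.circuits, e ∉ C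

/-- `D` is a circuit of the contraction `M/T`: a nonempty inclusion-minimal
member of `{C \ T : C a circuit of M}`. -/
def IsContractCircuit (M : BingoMatroid α) (T D : Finset α) : Prop :=
  D.Nonempty ∧ (∃ C ∈ M.circuits, D = C \ T) ∧
    ∀ C' ∈ M.circuits, (C' \ T).Nonempty → ¬ (C' \ T) ⊂ D

end BingoMatroid

namespace BingoMatroid

variable {α : Type*} [DecidableEq α] {M : BingoMatroid α} {I J C : Finset α} {c : α}

theorem Indep.subset (hJ : M.Indep J) (h : I ⊆ J) : M.Indep I :=
  ⟨h.trans hJ.1, fun D hD hDI => hJ.2 D hD (hDI.trans h)⟩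

theorem exists_circuit_of_not_indep (hI : I ⊆ M.E) (h : ¬ M.Indep I) :
    ∃ D ∈ M.circuits, D ⊆ I := by
  by_contra! hD
  exact h ⟨hI, hD⟩

theorem indep_erase (hC : C ∈ M.circuits) (hc : c ∈ C) : M.Indep (C.erase c) := by
  refine ⟨(erase_subset _ _).trans (M.subset_ground C hC), fun D hD hDC => ?_⟩
  have := M.antichain D hD C hC (hDC.trans (erase_subset _ _))
  subst this
  exact notMem_erase c D (hDC hc)

/-- The augmentation property of independent sets. -/
theorem Indep.exists_insert (hI : M.Indep I) (hJ : M.Indep J) (hlt : I.card < J.card) :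
    ∃ e ∈ J, e ∉ I ∧ M.Indep (insert e I) := by
  classical
  by_contra! hno
  let P : Finset (Finset α) := (I ∪ J).powerset.filter fun K => M.Indep K ∧ I.card < K.card
  have hP : P.Nonempty := ⟨J, by
    simp only [P, mem_filter, mem_powerset]
    exact ⟨subset_union_right, hJ, hlt⟩⟩
  obtain ⟨K, hKP, hmin⟩ := exists_min_image P (fun K => (I \ K).card) hP
  obtain ⟨hKIJ, hK, hIK⟩ : K ⊆ I ∪ J ∧ M.Indep K ∧ I.card < K.card := by
    simpa only [P, mem_filter, mem_powerset] using hKP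
  have hne : (I \ K).Nonempty := by
    rw [sdiff_nonempty]
    intro hsub
    obtain ⟨e, heK, heI⟩ := exists_mem_notMem_of_card_lt_card hIK
    have heJ : e ∈ J := by
      have := hKIJ heK
      simp only [mem_union] at this
      tauto
    exact hno e heJ heI (hK.subset (insert_subset heK hsub))
  obtain ⟨e, he⟩ := hne
  obtain ⟨heI, heK⟩ := mem_sdiff.1 he
  have key : ∀ f ∈ K \ I, ∃ D ∈ M.circuits, D ⊆ insert e (K.erase f) ∧ e ∈ D := by
    intro f hf
    obtain ⟨hfK, hfI⟩ := mem_sdiff.1 hf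
    have hcard : (insert e (K.erase f)).card = K.card := by
      rw [card_insert_of_notMem (by simp [heK]), card_erase_of_mem hfK]
      have := card_pos.2 ⟨f, hfK⟩
      omega
    have hsub : insert e (K.erase f) ⊆ I ∪ J :=
      insert_subset (mem_union_left _ heI) ((erase_subset _ _).trans hKIJ)
    have hnot : ¬ M.Indep (insert e (K.erase f)) := by
      intro hind
      have h1 := hmin (insert e (K.erase f)) (by
        simp only [P, mem_filter, mem_powerset]
        exact ⟨hsub, hind, by omega⟩)
      have h2 : I \ insert e (K.erase f) ⊂ I \ K := by
        refine (ssubset_iff_of_subset ?_).2 ⟨e, he, by simp⟩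
        intro x hx
        simp only [mem_sdiff, mem_insert, mem_erase, not_or, not_and] at hx ⊢
        refine ⟨hx.1, fun hxK => hx.2.2 ?_ hxK⟩
        rintro rfl
        exact hfI hx.1
      exact absurd (card_lt_card h2) (by omega)
    obtain ⟨D, hD, hDs⟩ := exists_circuit_of_not_indep
      (hsub.trans (union_subset hI.1 hJ.1)) hnot
    refine ⟨D, hD, hDs, ?_⟩
    by_contra heD
    exact hK.2 D hD (((subset_insert_iff_of_notMem heD).1 hDs).trans (erase_subset _ _))
  obtain ⟨g, hgK, hgI⟩ := exists_mem_notMem_of_card_lt_card hIK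
  obtain ⟨D, hD, hDs, heD⟩ := key g (mem_sdiff.2 ⟨hgK, hgI⟩)
  obtain ⟨h, hhD, hhI⟩ : ∃ h ∈ D, h ∉ I := by
    by_contra! hDI
    exact hI.2 D hD hDI
  have hhK : h ∈ K := by
    have := hDs hhD
    simp only [mem_insert, mem_erase] at this
    rcases this with rfl | this
    · exact absurd heI hhI
    · exact this.2
  obtain ⟨D', hD', hDs', heD'⟩ := key h (mem_sdiff.2 ⟨hhK, hhI⟩)
  have hne : D ≠ D' := by
    rintro rfl
    have := hDs' hhD
    simp only [mem_insert, mem_erase, ne_eq, not_true_eq_false, false_and, or_false] at this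
    exact hhI (this ▸ heI)
  obtain ⟨F, hF, hFs⟩ := M.elimination D hD D' hD' hne e (mem_inter.2 ⟨heD, heD'⟩)
  refine hK.2 F hF fun x hx => ?_
  have hx' := hFs hx
  simp only [mem_sdiff, mem_union, mem_singleton] at hx'
  rcases hx'.1 with h | h
  · have := hDs h
    simp only [mem_insert, mem_erase] at this
    tauto
  · have := hDs' h
    simp only [mem_insert, mem_erase] at this
    tauto

theorem indep_empty (M : BingoMatroid α) : M.Indep ∅ :=
  ⟨empty_subset _, fun _ hD h => M.empty_not_mem (subset_empty.1 h ▸ hD)⟩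

theorem bddAbove_card_indep (M : BingoMatroid α) :
    BddAbove {k : ℕ | ∃ I : Finset α, M.Indep I ∧ I.card = k} :=
  ⟨M.E.card, by rintro _ ⟨I, hI, rfl⟩; exact card_le_card hI.1⟩

theorem Indep.card_le_rank (hI : M.Indep I) : I.card ≤ M.rank :=
  le_csSup M.bddAbove_card_indep ⟨I, hI, rfl⟩

theorem exists_indep_card_eq_rank (M : BingoMatroid α) :
    ∃ I, M.Indep I ∧ I.card = M.rank :=
  Nat.sSup_mem (s := {k : ℕ | ∃ I : Finset α, M.Indep I ∧ I.card = k}) ⟨0, ∅, M.indep_empty, rfl⟩ M.bddAbove_card_indep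

theorem Indep.exists_superset_card_eq_rank (hI : M.Indep I) :
    ∃ J, M.Indep J ∧ I ⊆ J ∧ J.card = M.rank := by
  obtain ⟨B, hB, hBr⟩ := M.exists_indep_card_eq_rank
  induction hk : M.rank - I.card generalizing I with
  | zero => exact ⟨I, hI, Subset.rfl, le_antisymm hI.card_le_rank (by omega)⟩
  | succ k ih =>
    obtain ⟨e, -, heI, hind⟩ := hI.exists_insert hB (by omega)
    obtain ⟨J, hJ, hsub, hJr⟩ := ih hind (by rw [card_insert_of_notMem heI]; omega)
    exact ⟨J, hJ, (subset_insert _ _).trans hsub, hJr⟩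

/-- If `C` is a circuit, `c ∈ C` and `C.erase c ∪ J` is independent, then `C` is the only
circuit contained in `C ∪ J`. -/
theorem Indep.eq_of_subset_union (hC : C ∈ M.circuits) (hc : c ∈ C)
    (h : M.Indep (C.erase c ∪ J)) {D : Finset α} (hD : D ∈ M.circuits)
    (hDs : D ⊆ C ∪ J) : D = C := by
  by_contra hne
  by_cases hcD : c ∈ D
  · obtain ⟨F, hF, hFs⟩ := M.elimination D hD C hC hne c (mem_inter.2 ⟨hcD, hc⟩)
    refine h.2 F hF fun x hx => ?_
    have hx' := hFs hx
    have := @hDs x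
    simp only [mem_sdiff, mem_union, mem_singleton, mem_erase] at hx' this ⊢
    tauto
  · refine h.2 D hD fun x hx => ?_
    have := hDs hx
    simp only [mem_union, mem_erase] at this ⊢
    rcases this with h | h
    · exact Or.inl ⟨fun hxc => hcD (hxc ▸ hx), h⟩
    · exact Or.inr h

/-- In a basis, an element lying on some circuit can be exchanged for another element. -/
theorem Indep.exists_exchange (hI : M.Indep I) (hIr : I.card = M.rank) {b : α} (hb : b ∈ I)
    {D : Finset α} (hD : D ∈ M.circuits) (hbD : b ∈ D) :
    ∃ e, e ∉ I ∧ M.Indep (insert e (I.erase b)) := by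
  obtain ⟨X, hX, hDX, hXr⟩ := (indep_erase hD hbD).exists_superset_card_eq_rank
  have hbX : b ∉ X := fun h => hX.2 D hD (by
    rw [← insert_erase hbD]
    exact insert_subset h hDX)
  have hlt : (I.erase b).card < X.card := by
    rw [card_erase_of_mem hb]
    have := card_pos.2 ⟨b, hb⟩
    omega
  obtain ⟨e, heX, heI, hind⟩ := (hI.subset (erase_subset b I)).exists_insert hX hlt
  refine ⟨e, fun h => heI (mem_erase.2 ⟨?_, h⟩), hind⟩
  rintro rfl
  exact hbX heX

theorem Indep.mem_of_card_eq_rank (hI : M.Indep I) (hIr : I.card = M.rank) {e : α}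
    (he : M.IsColoop e) : e ∈ I := by
  by_contra heI
  have : M.Indep (insert e I) := ⟨insert_subset he.1 hI.1, fun D hD hDs =>
    hI.2 D hD ((subset_insert_iff_of_notMem (he.2 D hD)).1 hDs)⟩
  have := this.card_le_rank
  rw [card_insert_of_notMem heI] at this
  omega

end BingoMatroid

/-- The probability that, in a uniformly random ordering of `n` elements, the elements preceding
the last member of a fixed `k`-set `C` are the rest of `C` and exactly the members of a fixed
`s`-set disjoint from `C`. -/
noncomputable def prefixProb (k n s : ℕ) : ℚ :=
  k * ((k + s - 1).factorial * (n - k - s).factorial : ℕ) / (n.factorial : ℚ)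

theorem prefixProb_add {k n s : ℕ} (hk : 0 < k) (h : k + s ≤ n) :
    prefixProb k (n + 1) s + prefixProb k (n + 1) (s + 1) = prefixProb k n s := by
  obtain ⟨k, rfl⟩ := Nat.exists_eq_succ_of_ne_zero hk.ne'
  obtain ⟨l, rfl⟩ := Nat.exists_eq_add_of_le h
  have h1 : k.succ + s - 1 = k + s := by omega
  have h2 : k.succ + (s + 1) - 1 = k + s + 1 := by omega
  have h3 : k.succ + s + l + 1 - k.succ - s = l + 1 := by omega
  have h4 : k.succ + s + l + 1 - k.succ - (s + 1) = l := by omega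
  have h5 : k.succ + s + l - k.succ - s = l := by omega
  simp only [prefixProb, h1, h2, h3, h4, h5, Nat.factorial_succ]
  have : ((k.succ + s + l).factorial : ℚ) ≠ 0 := by positivity
  have : ((k : ℚ) + 1 + s + l + 1) ≠ 0 := by positivity
  push_cast
  field_simp
  ring

theorem sum_powerset_prefixProb {α : Type*} [DecidableEq α] {k : ℕ} (hk : 0 < k)
    (X : Finset α) (n s : ℕ) (h : k + s ≤ n) :
    ∑ S ∈ X.powerset, prefixProb k (n + X.card) (s + S.card) = prefixProb k n s := by
  induction X using Finset.induction_on generalizing n s with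
  | empty => simp
  | insert a X ha ih =>
    rw [sum_powerset_insert ha, card_insert_of_notMem ha]
    have hins : ∀ S ∈ X.powerset, prefixProb k (n + (X.card + 1)) (s + (insert a S).card) =
        prefixProb k (n + 1 + X.card) (s + 1 + S.card) := by
      intro S hS
      rw [card_insert_of_notMem fun h => ha (mem_powerset.1 hS h)]
      congr 1 <;> omega
    rw [sum_congr rfl hins, ih (n + 1) (s + 1) (by omega),
      show n + (X.card + 1) = n + 1 + X.card by omega, ih (n + 1) s (by omega),
      prefixProb_add hk h]

theorem prefixProb_zero {k n : ℕ} (hk : 0 < k) (h : k ≤ n) :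
    prefixProb k n 0 = (n.choose k : ℚ)⁻¹ := by
  rw [Nat.cast_choose ℚ h, inv_div, prefixProb]
  simp only [add_zero, Nat.sub_zero]
  rw [← Nat.mul_factorial_pred hk.ne']
  push_cast
  ring

theorem prefixProb_eq {k n s : ℕ} (hk : 0 < k) (h : k + s ≤ n) :
    prefixProb k n s = (k : ℚ) / n * ((n - 1).choose (k + s - 1) : ℚ)⁻¹ := by
  rw [Nat.cast_choose ℚ (by omega), inv_div, prefixProb,
    ← Nat.mul_factorial_pred (n := n) (by omega),
    show n - 1 - (k + s - 1) = n - k - s by omega]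
  push_cast
  rw [div_mul_div_comm]

/-- There are at least `|S|! (n - |S| - 1)!` orderings listing first the elements of `S`
and then `c`. -/
theorem le_card_orderings {β : Type*} [Fintype β] [DecidableEq β] {n : ℕ}
    (hn : Fintype.card β = n) (S : Finset β) {c : β} (hc : c ∉ S) :
    S.card.factorial * (n - (S.card + 1)).factorial ≤
      Nat.card {σ : Fin n ≃ β // ∀ i, (σ i ∈ S ↔ (i : ℕ) < S.card) ∧
        (σ i = c ↔ (i : ℕ) = S.card)} := by
  classical
  let f : β → Fin 3 := fun b => if b ∈ S then 0 else if b = c then 1 else 2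
  let g : Fin n → Fin 3 := fun i => if (i : ℕ) < S.card then 0
    else if (i : ℕ) = S.card then 1 else 2
  have hlt : S.card < n := by
    rw [← hn, ← card_univ]
    exact card_lt_card (ssubset_univ_iff.2 fun h => hc (h ▸ mem_univ c))
  have hf0 : Fintype.card {b // f b = 0} = S.card := by
    rw [Fintype.card_subtype]
    congr 1
    ext b
    by_cases hb : b ∈ S <;> by_cases hbc : b = c <;> simp [f, hb, hbc]
  have hf1 : Fintype.card {b // f b = 1} = 1 := by
    rw [Fintype.card_subtype, card_eq_one]
    refine ⟨c, ?_⟩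
    ext b
    by_cases hb : b ∈ S <;> by_cases hbc : b = c <;> simp [f, hb, hbc, hc]
  have hf : ∑ j, Fintype.card {b // f b = j} = n := by
    rw [← hn, ← Fintype.card_sigma]
    exact Fintype.card_congr (Equiv.sigmaFiberEquiv f)
  have hg : ∑ j, Fintype.card {i // g i = j} = n := by
    rw [← Fintype.card_sigma]
    exact (Fintype.card_congr (Equiv.sigmaFiberEquiv g)).trans (Fintype.card_fin n)
  have hg0 : Fintype.card {i // g i = 0} = S.card := by
    rw [Fintype.card_subtype]
    have : (univ.filter fun i => g i = 0) = Iio (⟨S.card, hlt⟩ : Fin n) := by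
      ext i
      simp only [g, mem_filter, mem_univ, true_and, mem_Iio, Fin.lt_def]
      split_ifs <;> simp_all
    rw [this, Fin.card_Iio]
  have hg1 : Fintype.card {i // g i = 1} = 1 := by
    rw [Fintype.card_subtype, card_eq_one]
    refine ⟨⟨S.card, hlt⟩, ?_⟩
    ext i
    simp only [g, mem_filter, mem_univ, true_and, mem_singleton, Fin.ext_iff]
    split_ifs <;> simp_all <;> omega
  rw [Fin.sum_univ_three] at hf hg
  have hfg : ∀ j, Nonempty ({i // g i = j} ≃ {b // f b = j}) := by
    intro j
    refine ⟨Fintype.equivOfCardEq ?_⟩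
    fin_cases j <;> simp only [Fin.zero_eta, Fin.mk_one, Fin.reduceFinMk] <;> omega
  let e := fun j => (hfg j).some
  let σ₀ : Fin n ≃ β := Equiv.ofFiberEquiv e
  have hσ₀ : ∀ i, f (σ₀ i) = g i := Equiv.ofFiberEquiv_map e
  have hstab : Nat.card {π : Equiv.Perm β // f ∘ π = f} =
      S.card.factorial * (n - (S.card + 1)).factorial := by
    rw [Nat.card_eq_fintype_card, DomMulAct.stabilizer_card, Fin.prod_univ_three, hf0, hf1,
      show Fintype.card {b // f b = 2} = n - (S.card + 1) by omega]
    simp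
  rw [← hstab]
  refine Nat.card_le_card_of_injective (fun π => ⟨σ₀.trans π.1, fun i => ?_⟩) ?_
  · have h : f (π.1 (σ₀ i)) = g i := (congrFun π.2 (σ₀ i)).trans (hσ₀ i)
    simp only [Equiv.trans_apply]
    generalize π.1 (σ₀ i) = b at h
    simp only [f, g] at h
    have hbc : b ∈ S → b ≠ c := fun hb h => hc (h ▸ hb)
    have hi : (i : ℕ) < S.card → (i : ℕ) ≠ S.card := ne_of_lt
    split_ifs at h <;> simp_all
  · intro π π' h
    ext b
    have := congrArg (fun τ : Fin n ≃ β => τ (σ₀.symm b)) (Subtype.ext_iff.1 h)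
    simpa using this

/-- The ordering `σ` lists first the elements of `S` and then `c`. -/
def StartsWith {α : Type*} {n : ℕ} (σ : Fin n → α) (S : Finset α) (c : α) : Prop :=
  ∀ i, (σ i ∈ S ↔ (i : ℕ) < S.card) ∧ (σ i = c ↔ (i : ℕ) = S.card)

namespace BingoMatroid

variable {α : Type*} [DecidableEq α] {M : BingoMatroid α} {I J C : Finset α} {c : α}

theorem le_card_startsWith (M : BingoMatroid α) {S : Finset α} (hS : S ⊆ M.E) (hcE : c ∈ M.E)
    (hc : c ∉ S) :
    S.card.factorial * (M.E.card - (S.card + 1)).factorial ≤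
      Nat.card {σ : Fin M.E.card ≃ {x // x ∈ M.E} // StartsWith (fun i => (σ i : α)) S c} := by
  have hcard : (S.subtype (· ∈ M.E)).card = S.card := by
    rw [card_subtype, filter_true_of_mem fun x hx => hS hx]
  have h := le_card_orderings (n := M.E.card) (by simp) (S.subtype (· ∈ M.E))
    (c := ⟨c, hcE⟩) (by simpa using hc)
  rw [hcard] at h
  refine h.trans (Nat.card_le_card_of_injective (fun σ => ⟨σ.1, fun i => ?_⟩) ?_)
  · simpa [Subtype.ext_iff] using σ.2 i
  · intro σ τ hστ
    exact Subtype.ext (congrArg (fun ρ => ρ.1) hστ)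

theorem wins_of_startsWith (hC : C ∈ M.circuits) (hJ : ∀ D ∈ M.circuits, D ⊆ C ∪ J → D = C)
    {σ : Fin M.E.card ≃ {x // x ∈ M.E}}
    (h : StartsWith (fun i => (σ i : α)) (C.erase c ∪ J) c) (hc : c ∈ C) : M.Wins σ C := by
  intro D hD hne
  have hCt : hitTime (fun i => (σ i : α)) C ≤ (C.erase c ∪ J).card + 1 := by
    refine Nat.sInf_le fun x hx => ⟨σ.symm ⟨x, M.subset_ground C hC hx⟩, ?_, by simp⟩
    have hx' := h (σ.symm ⟨x, M.subset_ground C hC hx⟩)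
    simp only [Equiv.apply_symm_apply] at hx'
    by_cases hxc : x = c
    · have := hx'.2.1 hxc
      omega
    · have := hx'.1.1 (mem_union_left _ (mem_erase.2 ⟨hxc, hx⟩))
      omega
  by_contra hlt
  have hmem : ∀ x ∈ D, ∃ i : Fin M.E.card,
      (i : ℕ) < hitTime (fun i => (σ i : α)) D ∧ (σ i : α) = x :=
    Nat.sInf_mem (s := {t : ℕ | ∀ x ∈ D, ∃ i : Fin M.E.card, (i : ℕ) < t ∧ (σ i : α) = x})
      ⟨M.E.card, fun x hx => ⟨σ.symm ⟨x, M.subset_ground D hD hx⟩, Fin.is_lt _, by simp⟩⟩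
  refine hne (hJ D hD fun x hx => ?_)
  obtain ⟨i, hi, rfl⟩ := hmem x hx
  rcases (show (i : ℕ) < (C.erase c ∪ J).card ∨ (i : ℕ) = (C.erase c ∪ J).card by omega)
    with h' | h'
  · exact union_subset_union (erase_subset _ _) Subset.rfl ((h i).1.2 h')
  · exact mem_union_left _ (by simpa only [(h i).2.2 h'] using hc)

theorem startsWith_unique {σ : Fin M.E.card ≃ {x // x ∈ M.E}} (hC : C ⊆ M.E) {J' : Finset α}
    {c' : α} (hc : c ∈ C) (hc' : c' ∈ C) (hJ : J ⊆ M.E \ C) (hJ' : J' ⊆ M.E \ C)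
    (h : StartsWith (fun i => (σ i : α)) (C.erase c ∪ J) c)
    (h' : StartsWith (fun i => (σ i : α)) (C.erase c' ∪ J') c') : J = J' ∧ c = c' := by
  have hcard : ∀ {J J' : Finset α} {c c' : α}, c' ∈ C →
      StartsWith (fun i => (σ i : α)) (C.erase c ∪ J) c →
      StartsWith (fun i => (σ i : α)) (C.erase c' ∪ J') c' →
      (C.erase c' ∪ J').card ≤ (C.erase c ∪ J).card := by
    intro J J' c c' hc' h h'
    have h1 := h (σ.symm ⟨c', hC hc'⟩)
    have h2 := h' (σ.symm ⟨c', hC hc'⟩)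
    simp only [Equiv.apply_symm_apply] at h1 h2
    have h3 := h2.2.1 trivial
    by_cases hcc : c' = c
    · have := h1.2.1 hcc
      omega
    · have := h1.1.1 (mem_union_left _ (mem_erase.2 ⟨hcc, hc'⟩))
      omega
  have heq := le_antisymm (hcard hc h' h) (hcard hc' h h')
  have hsub : ∀ {J J' : Finset α} {c c' : α}, J ⊆ M.E \ C →
      StartsWith (fun i => (σ i : α)) (C.erase c ∪ J) c →
      StartsWith (fun i => (σ i : α)) (C.erase c' ∪ J') c' →
      (C.erase c ∪ J).card = (C.erase c' ∪ J').card → J ⊆ J' := by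
    intro J J' c c' hJ h h' heq x hx
    obtain ⟨hxE, hxC⟩ := mem_sdiff.1 (hJ hx)
    have h1 := (h (σ.symm ⟨x, hxE⟩)).1
    have h2 := (h' (σ.symm ⟨x, hxE⟩)).1
    simp only [Equiv.apply_symm_apply] at h1 h2
    have h3 := h2.2 (heq ▸ h1.1 (mem_union_right _ hx))
    exact (mem_union.1 h3).resolve_left fun h4 => hxC (mem_of_mem_erase h4)
  refine ⟨Subset.antisymm (hsub hJ h h' heq) (hsub hJ' h' h heq.symm), ?_⟩
  have h1 := (h (σ.symm ⟨c, hC hc⟩)).2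
  have h2 := (h' (σ.symm ⟨c, hC hc⟩)).2
  simp only [Equiv.apply_symm_apply] at h1 h2
  exact h2.2 ((h1.1 trivial).trans heq)

/-- `C` wins whenever the elements called before its completion form, together with `C`, a set
containing no other circuit. -/
theorem sum_prefixProb_le_beta (hC : C ∈ M.circuits) (G : Finset (Finset α))
    (hG : ∀ J ∈ G, J ⊆ M.E \ C) (hGC : ∀ J ∈ G, ∀ D ∈ M.circuits, D ⊆ C ∪ J → D = C) :
    ∑ J ∈ G, prefixProb C.card M.E.card J.card ≤ M.beta C := by
  classical
  have hCE := M.subset_ground C hC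
  let A : Finset α × α → Finset (Fin M.E.card ≃ {x // x ∈ M.E}) := fun p =>
    univ.filter fun σ => StartsWith (fun i => (σ i : α)) (C.erase p.2 ∪ p.1) p.2
  have hcount : ∑ J ∈ G, C.card * ((C.card + J.card - 1).factorial *
      (M.E.card - C.card - J.card).factorial) ≤
      Nat.card {σ : Fin M.E.card ≃ {x // x ∈ M.E} // M.Wins σ C} := by
    calc
      _ ≤ ∑ p ∈ G ×ˢ C, (A p).card := by
        rw [sum_product]
        refine sum_le_sum fun J hJ => ?_
        rw [← smul_eq_mul, ← sum_const]
        refine sum_le_sum fun c hc => ?_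
        have hJC : Disjoint C J := disjoint_right.2 fun x hx => (mem_sdiff.1 (hG J hJ hx)).2
        have hcJ : c ∉ C.erase c ∪ J := by
          simp [disjoint_left.1 hJC hc]
        have hpos := card_pos.2 ⟨c, hc⟩
        have hcard : (C.erase c ∪ J).card = C.card + J.card - 1 := by
          rw [card_union_of_disjoint (hJC.mono_left (erase_subset _ _)), card_erase_of_mem hc]
          omega
        have := M.le_card_startsWith (union_subset ((erase_subset c C).trans hCE)
          ((hG J hJ).trans sdiff_subset)) (hCE hc) hcJ
        rw [hcard, show M.E.card - (C.card + J.card - 1 + 1) = M.E.card - C.card - J.card by omega,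
          Nat.card_eq_fintype_card, Fintype.card_subtype] at this
        exact this
      _ = ((G ×ˢ C).biUnion A).card := by
        refine (card_biUnion fun p hp q hq hpq => disjoint_left.2 fun σ h h' => hpq ?_).symm
        have hp := mem_product.1 hp
        have hq := mem_product.1 hq
        simp only [A, mem_filter, mem_univ, true_and] at h h'
        exact Prod.ext_iff.2 (startsWith_unique hCE hp.2 hq.2 (hG _ hp.1) (hG _ hq.1) h h')
      _ ≤ _ := by
        rw [Nat.card_eq_fintype_card, Fintype.card_subtype]
        refine card_le_card fun σ hσ => ?_
        simp only [A, mem_biUnion, mem_product, mem_filter, mem_univ, true_and] at hσ ⊢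
        obtain ⟨p, ⟨hp, hpc⟩, h⟩ := hσ
        exact wins_of_startsWith hC (hGC p.1 hp) h hpc
  simp only [prefixProb, beta]
  rw [← sum_div]
  gcongr
  exact_mod_cast hcount

/-- Completing a circuit `C` minus an element to a basis yields a basis of the contraction of
`C`. -/
theorem exists_basis_contract (hC : C ∈ M.circuits) (hc : c ∈ C) :
    ∃ B ⊆ M.E \ C, M.Indep (C.erase c ∪ B) ∧ (C.erase c ∪ B).card = M.rank := by
  obtain ⟨A, hA, hCA, hAr⟩ := (indep_erase hC hc).exists_superset_card_eq_rank
  have hcA : c ∉ A := fun h => hA.2 C hC (by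
    rw [← insert_erase hc]
    exact insert_subset h hCA)
  have hunion : C.erase c ∪ A \ C = A := by
    ext x
    have := @hCA x
    simp only [mem_union, mem_erase, mem_sdiff] at this ⊢
    by_cases hx : x = c
    · subst hx
      tauto
    · tauto
  exact ⟨A \ C, sdiff_subset_sdiff hA.1 Subset.rfl, by rwa [hunion], by rwa [hunion]⟩

theorem beta_eq_one (h : ∀ D ∈ M.circuits, D = C) : M.beta C = 1 := by
  have hall : ∀ σ, M.Wins σ C := fun σ D hD hne => absurd (h D hD) hne
  rw [beta, Nat.card_congr (Equiv.subtypeUnivEquiv hall), Nat.card_eq_fintype_card,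
    Fintype.card_equiv M.E.equivFin.symm, Fintype.card_fin, div_self]
  positivity

/-- Any set missing a non-coloop of a basis `B` of the contraction of `C` can be augmented by an
element outside `B`. -/
theorem exists_insert_contract (hC : C ∈ M.circuits) (hc : c ∈ C) {B : Finset α}
    (hBC : B ⊆ M.E \ C) (hB : M.Indep (C.erase c ∪ B)) (hBr : (C.erase c ∪ B).card = M.rank)
    (hJ : J ⊆ B)
    (hJB : ¬ B \ M.E.filter (fun e => ∀ D ∈ M.circuits, e ∉ D) ⊆ J) :
    ∃ e ∈ M.E \ C, e ∉ B ∧ ∀ D ∈ M.circuits, D ⊆ C ∪ insert e J → D = C := by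
  obtain ⟨b, hb, hbJ⟩ := not_subset.1 hJB
  obtain ⟨hbB, hbL⟩ := mem_sdiff.1 hb
  obtain ⟨hbE, hbC⟩ := mem_sdiff.1 (hBC hbB)
  obtain ⟨D, hD, hbD⟩ : ∃ D ∈ M.circuits, b ∈ D := by
    by_contra! hno
    exact hbL (mem_filter.2 ⟨hbE, hno⟩)
  obtain ⟨e, heA, he⟩ := hB.exists_exchange hBr (mem_union_right _ hbB) hD hbD
  have hec : e ≠ c := by
    rintro rfl
    refine he.2 C hC fun x hx => ?_
    by_cases hxe : x = e
    · simp [hxe]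
    · have : x ≠ b := fun h => hbC (h ▸ hx)
      simp [hxe, hx, this]
  have heB : e ∉ B := fun h => heA (mem_union_right _ h)
  have heC : e ∉ C := fun h => heA (mem_union_left _ (mem_erase.2 ⟨hec, h⟩))
  refine ⟨e, mem_sdiff.2 ⟨he.1 (mem_insert_self _ _), heC⟩, heB, fun D hD hDs => ?_⟩
  refine Indep.eq_of_subset_union hC hc (he.subset fun x hx => ?_) hD hDs
  have hxJ := @hJ x
  have hxb : x = b → x ∉ C ∧ x ∉ J := by
    rintro rfl
    exact ⟨hbC, hbJ⟩
  simp only [mem_union, mem_erase, mem_insert] at hx ⊢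
  tauto

theorem sum_filter_powerset_prefixProb {k n : ℕ} (hk : 0 < k) {B L : Finset α} (hL : L ⊆ B)
    (h : k + (B \ L).card + 1 + L.card ≤ n) :
    ∑ J ∈ B.powerset with B \ L ⊆ J, prefixProb k n (J.card + 1) =
      prefixProb k (n - L.card) ((B \ L).card + 1) := by
  rw [← sum_powerset_prefixProb hk L (n - L.card) _ (by omega),
    show n - L.card + L.card = n by omega]
  refine sum_nbij' (fun J => J ∩ L) (fun S => B \ L ∪ S) ?_ ?_ ?_ ?_ ?_
  · intro J _
    exact mem_powerset.2 inter_subset_right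
  · intro S hS
    exact mem_filter.2 ⟨mem_powerset.2 (union_subset sdiff_subset ((mem_powerset.1 hS).trans hL)),
      subset_union_left⟩
  · intro J hJ
    simp only [mem_filter, mem_powerset] at hJ
    ext x
    have h1 := @hJ.1 x
    have h2 := @hJ.2 x
    simp only [mem_union, mem_sdiff, mem_inter] at h2 ⊢
    tauto
  · intro S hS
    ext x
    have hxS := mem_powerset.1 hS
    replace hxS := @hxS x
    simp only [mem_union, mem_sdiff, mem_inter]
    tauto
  · intro J hJ
    simp only [mem_filter, mem_powerset] at hJ
    have h1 : J \ L = B \ L := by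
      ext x
      have h1 := @hJ.1 x
      have h2 := @hJ.2 x
      simp only [mem_sdiff] at h2 ⊢
      tauto
    have := card_sdiff_add_card_inter J L
    rw [h1] at this
    congr 1
    omega

end BingoMatroid

/-- sharp lower bound on `β_C` taking the number `m` of coloops
into account; if `n = r + 1` then `β_C = 1`. -/
theorem stmt6 {α : Type*} [DecidableEq α] (M : BingoMatroid α) (hE : M.E.Nonempty)
    (C : Finset α) (hC : C ∈ M.circuits)
    (r d n m : ℕ) (hr : M.rank = r) (hn : M.E.card = n)
    (hCcard : C.card = r + 1 - d) (hd : d < r + 1)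
    (hm : m = (M.E.filter (fun e => ∀ C' ∈ M.circuits, e ∉ C')).card) :
    (n = r + 1 → M.beta C = 1) ∧
    (r + 1 < n →
      (Nat.choose (n - 1 - d) C.card : ℚ)⁻¹ -
          (C.card : ℚ) / ((n - m : ℕ) : ℚ) * (Nat.choose (n - m - 1) (r - m + 1) : ℚ)⁻¹
        ≤ M.beta C) := by
  obtain ⟨c, hc⟩ : C.Nonempty := nonempty_iff_ne_empty.2 fun h => M.empty_not_mem (h ▸ hC)
  obtain ⟨B, hBC, hB, hBr⟩ := BingoMatroid.exists_basis_contract hC hc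
  have hCB : Disjoint C B := disjoint_right.2 fun x hx => (mem_sdiff.1 (hBC hx)).2
  have hCE := M.subset_ground C hC
  have hk : 0 < C.card := card_pos.2 ⟨c, hc⟩
  have hcard : C.card + B.card = r + 1 := by
    rw [card_union_of_disjoint (hCB.mono_left (erase_subset _ _)), card_erase_of_mem hc] at hBr
    omega
  have hBd : B.card = d := by omega
  have hBgood : ∀ D ∈ M.circuits, D ⊆ C ∪ B → D = C := fun D hD hDs =>
    BingoMatroid.Indep.eq_of_subset_union hC hc hB hD hDs
  refine ⟨fun h => BingoMatroid.beta_eq_one fun D hD => hBgood D hD ?_, fun h => ?_⟩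
  · have : C ∪ B = M.E := by
      refine eq_of_subset_of_card_le (union_subset hCE (hBC.trans sdiff_subset)) ?_
      rw [card_union_of_disjoint hCB]
      omega
    exact this ▸ M.subset_ground D hD
  set L := M.E.filter (fun e => ∀ C' ∈ M.circuits, e ∉ C') with hLdef
  have hLB : L ⊆ B := by
    intro e he
    have he' : M.IsColoop e := mem_filter.1 he
    exact (mem_union.1 (hB.mem_of_card_eq_rank hBr he')).resolve_left
      fun h => he'.2 C hC (mem_of_mem_erase h)
  have hBL : (B \ L).card = d - m := by rw [card_sdiff_of_subset hLB, hBd, hm]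
  have hmd : m ≤ d := by rw [hm, ← hBd]; exact card_le_card hLB
  have hex : ∀ J : Finset α, J ⊆ B ∧ ¬ B \ L ⊆ J →
      ∃ e, e ∈ M.E \ C ∧ e ∉ B ∧ ∀ D ∈ M.circuits, D ⊆ C ∪ insert e J → D = C :=
    fun J hJ => by simpa using BingoMatroid.exists_insert_contract hC hc hBC hB hBr hJ.1 hJ.2
  have : Nonempty α := ⟨c⟩
  choose! g hgE hgB hgood using hex
  let Q := B.powerset.filter fun J => ¬ B \ L ⊆ J
  have hQ : ∀ J ∈ Q, J ⊆ B ∧ ¬ B \ L ⊆ J := fun J hJ => by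
    simpa only [Q, mem_filter, mem_powerset] using hJ
  have hinj : Set.InjOn (fun J => insert (g J) J) Q := by
    have hinter : ∀ J ∈ Q, insert (g J) J ∩ B = J := fun J hJ => by
      rw [insert_inter_of_notMem (hgB J (hQ J hJ)), inter_eq_left.2 (hQ J hJ).1]
    intro J hJ J' hJ' heq
    rw [← hinter J hJ, ← hinter J' hJ']
    exact congrArg (· ∩ B) heq
  have hdisj : Disjoint B.powerset (Q.image fun J => insert (g J) J) := by
    refine disjoint_right.2 fun K hK hKB => ?_
    obtain ⟨J, hJ, rfl⟩ := mem_image.1 hK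
    exact hgB J (hQ J hJ) (mem_powerset.1 hKB (mem_insert_self _ _))
  have hbound := BingoMatroid.sum_prefixProb_le_beta hC
    (B.powerset ∪ Q.image fun J => insert (g J) J) (by
      intro K hK
      rcases mem_union.1 hK with hK | hK
      · exact (mem_powerset.1 hK).trans hBC
      · obtain ⟨J, hJ, rfl⟩ := mem_image.1 hK
        exact insert_subset (hgE J (hQ J hJ)) ((hQ J hJ).1.trans hBC)) (by
      intro K hK D hD hDs
      rcases mem_union.1 hK with hK | hK
      · exact hBgood D hD (hDs.trans (union_subset_union Subset.rfl (mem_powerset.1 hK)))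
      · obtain ⟨J, hJ, rfl⟩ := mem_image.1 hK
        exact hgood J (hQ J hJ) D hD hDs)
  rw [sum_union hdisj, sum_image hinj, hn] at hbound
  have hins : ∀ J ∈ Q, prefixProb C.card n (insert (g J) J).card =
      prefixProb C.card n (J.card + 1) := fun J hJ => by
    rw [card_insert_of_notMem fun h => hgB J (hQ J hJ) ((hQ J hJ).1 h)]
  rw [sum_congr rfl hins] at hbound
  have hsplit := sum_filter_add_sum_filter_not B.powerset (fun J => B \ L ⊆ J)
    fun J => prefixProb C.card n (J.card + 1)
  rw [BingoMatroid.sum_filter_powerset_prefixProb hk hLB (by omega), hBL, ← hm] at hsplit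
  have h0 := sum_powerset_prefixProb hk B (n - d) 0 (by omega)
  have h1 := sum_powerset_prefixProb hk B (n - d) 1 (by omega)
  simp only [zero_add, hBd, show n - d + d = n by omega] at h0
  simp only [add_comm 1, hBd, show n - d + d = n by omega] at h1
  have hrec := prefixProb_add (k := C.card) (n := n - 1 - d) (s := 0) hk (by omega)
  rw [show n - 1 - d + 1 = n - d by omega, prefixProb_zero (n := n - 1 - d) hk (by omega)] at hrec
  have hlast := prefixProb_eq (k := C.card) (n := n - m) (s := d - m + 1) hk (by omega)
  rw [show C.card + (d - m + 1) - 1 = r - m + 1 by omega] at hlast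
  rw [hlast] at hsplit
  simp only [Q] at hbound
  rw [zero_add] at hrec
  linarith
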